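/- arXiv:1212.3156 — 4 statements merged into one kernel-verified Lean document; each statement's English description precedes it below -/
import Mathlib

section
/- Let a cluster with N modes and M triads be given by maps p, q, r : {1,…,M} → {1,…,N} with p(m), q(m), r(m) pairwise distinct for each m, and suppose the triads are pairwise distinct in the sense that the pairs ({p(m),q(m)}, r(m)) (unordered pair of the two first modes together with the third mode) are distinct for distinct m. Let W_m ∈ ℂ with W_m ≠ 0 for all m, and let φ : {1,…,N} → ℝ. If for every choice of complex amplitudes b : {1,…,N} → ℂ one has Σ_{m=1}^{M} (φ_{p(m)} + φ_{q(m)} − φ_{r(m)}) · Im( W_m · b_{p(m)} · b_{q(m)} · conj(b_{r(m)}) ) = 0, then φ_{p(m)} + φ_{q(m)} − φ_{r(m)} = 0 for every m = 1,…,M. (This is the converse part of the invariance theorem: if Σ φ_n |b_n|² is conserved along all solutions of the cluster's three-wave equations, the density φ must satisfy the resonance conditions of every triad.) -/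
/-- converse part of the invariance theorem. If the quadratic form with
density `φ` is conserved along all solutions (i.e. its derivative vanishes for every
choice of amplitudes), then `φ` satisfies the resonance conditions of every triad. -/
theorem cluster_quadratic_invariant_converse {N M : ℕ} (p q r : Fin M → Fin N)
    (hdist : ∀ m, p m ≠ q m ∧ p m ≠ r m ∧ q m ≠ r m)
    (htriads : ∀ m m' : Fin M, m ≠ m' →
      ((({p m, q m} : Finset (Fin N)), r m) ≠ (({p m', q m'} : Finset (Fin N)), r m')))
    (W : Fin M → ℂ) (hW : ∀ m, W m ≠ 0)
    (φ : Fin N → ℝ)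
    (h : ∀ b : Fin N → ℂ,
      ∑ m, (φ (p m) + φ (q m) - φ (r m)) *
        (W m * b (p m) * b (q m) * (starRingEnd ℂ) (b (r m))).im = 0) :
    ∀ m, φ (p m) + φ (q m) - φ (r m) = 0 := by
  intro m0
  set b : ℂ → Fin N → ℂ := fun u n =>
    if n = p m0 ∨ n = q m0 then u else if n = r m0 then Complex.I * W m0 else 0 with hb
  obtain ⟨d1, d2, d3⟩ := hdist m0
  have key : ∀ m, m ≠ m0 →
      W m * b 1 (p m) * b 1 (q m) * (starRingEnd ℂ) (b 1 (r m)) =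
      W m * b Complex.I (p m) * b Complex.I (q m) * (starRingEnd ℂ) (b Complex.I (r m)) := by
    intro m hm
    obtain ⟨e1, e2, e3⟩ := hdist m
    have ht := htriads m m0 hm
    have h1 : ¬ (p m = p m0 ∧ q m = q m0 ∧ r m = r m0) := by
      rintro ⟨x, y, z⟩
      exact ht (by rw [x, y, z])
    have h2 : ¬ (p m = q m0 ∧ q m = p m0 ∧ r m = r m0) := by
      rintro ⟨x, y, z⟩
      exact ht (by rw [x, y, z, Finset.pair_comm])
    have hI : Complex.I * Complex.I = -1 := Complex.I_mul_I
    have hc : (starRingEnd ℂ) Complex.I = -Complex.I := Complex.conj_I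
    have h0 : (starRingEnd ℂ) (0 : ℂ) = 0 := map_zero _
    have h11 : (starRingEnd ℂ) (1 : ℂ) = 1 := map_one _
    simp only [hb]
    split_ifs <;> (try simp only [hc, h0, h11]) <;> grind
  have hs : ∑ m, ((φ (p m) + φ (q m) - φ (r m)) *
        (W m * b 1 (p m) * b 1 (q m) * (starRingEnd ℂ) (b 1 (r m))).im -
        (φ (p m) + φ (q m) - φ (r m)) *
        (W m * b Complex.I (p m) * b Complex.I (q m) *
          (starRingEnd ℂ) (b Complex.I (r m))).im) = 0 := by
    rw [Finset.sum_sub_distrib, h, h, sub_zero]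
  rw [Finset.sum_eq_single m0 (fun m _ hm => by rw [key m hm, sub_self])
    (fun hm => absurd (Finset.mem_univ m0) hm)] at hs
  have v1 : ∀ u, b u (p m0) = u := fun u => by simp [hb]
  have v2 : ∀ u, b u (q m0) = u := fun u => by simp [hb]
  have v3 : ∀ u, b u (r m0) = Complex.I * W m0 := fun u => by
    simp [hb, d2.symm, d3.symm]
  rw [v1, v2, v3, v1, v2, v3] at hs
  have hn : Complex.normSq (W m0) ≠ 0 := fun hz => hW m0 (Complex.normSq_eq_zero.mp hz)
  rw [Complex.normSq_apply] at hn
  simp at hs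
  have : (φ (p m0) + φ (q m0) - φ (r m0)) *
      ((W m0).re * (W m0).re + (W m0).im * (W m0).im) = 0 := by linarith
  exact (mul_eq_zero.mp this).resolve_right hn
end

section
/- Let A be an (M+2) × (N+2) matrix over a field, with rows indexed by {0,1,…,M+1} and columns indexed by {0,1,…,N+1}. Suppose columns 0 and 1 are zero outside the first two rows (A_{m,0} = A_{m,1} = 0 for all m ≥ 2), and suppose the 2 × 2 block B = [[A_{0,0}, A_{0,1}], [A_{1,0}, A_{1,1}]] is invertible. Let A'' be the M × N matrix obtained from A by deleting rows 0, 1 and columns 0, 1. Then the null space of A has the same dimension as the null space of A''; moreover, every null vector φ of A is uniquely determined by its restriction (φ_2,…,φ_{N+1}), which is a null vector of A''. -/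
/-- cluster reduction, part 2: deleting a pair of triads joined by two
modes belonging to no other triad (an invertible 2×2 block) preserves the nullity,
and every null vector of `A` is uniquely determined by its restriction, which is a
null vector of the reduced matrix `A''`. -/
theorem nullity_delete_kite {M N : ℕ} (F : Type*) [Field F]
    (A : Matrix (Fin (M + 2)) (Fin (N + 2)) F)
    (hcols : ∀ m : Fin M, A m.succ.succ 0 = 0 ∧ A m.succ.succ 1 = 0)
    (hblock : IsUnit (Matrix.det !![A 0 0, A 0 1; A 1 0, A 1 1]))
    (A'' : Matrix (Fin M) (Fin N) F)
    (hA'' : ∀ (m : Fin M) (n : Fin N), A'' m n = A m.succ.succ n.succ.succ) :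
    Module.finrank F (LinearMap.ker A.mulVecLin) =
      Module.finrank F (LinearMap.ker A''.mulVecLin)
    ∧ (∀ φ : Fin (N + 2) → F, A.mulVec φ = 0 →
        A''.mulVec (fun n => φ n.succ.succ) = 0)
    ∧ (∀ φ ψ : Fin (N + 2) → F, A.mulVec φ = 0 → A.mulVec ψ = 0 →
        (∀ n : Fin N, φ n.succ.succ = ψ n.succ.succ) → φ = ψ) := by
  have hd : A 0 0 * A 1 1 - A 0 1 * A 1 0 ≠ 0 := by
    have h := hblock.ne_zero
    rwa [Matrix.det_fin_two_of] at h
  have key : ∀ φ : Fin (N + 2) → F, A.mulVec φ = 0 ↔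
      (A 0 0 * φ 0 + (A 0 1 * φ 1 + ∑ n : Fin N, A 0 n.succ.succ * φ n.succ.succ) = 0 ∧
       A 1 0 * φ 0 + (A 1 1 * φ 1 + ∑ n : Fin N, A 1 n.succ.succ * φ n.succ.succ) = 0 ∧
       A''.mulVec (fun n => φ n.succ.succ) = 0) := by
    intro φ
    have h3 : ∀ m : Fin M, A.mulVec φ m.succ.succ =
        A''.mulVec (fun n => φ n.succ.succ) m := by
      intro m
      have h0 := (hcols m).1
      have h1 := (hcols m).2
      simp only [Matrix.mulVec, dotProduct, Fin.sum_univ_succ, Fin.succ_zero_eq_one, h0, h1, hA'',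
        zero_mul, zero_add]
    have hr : ∀ i, A.mulVec φ i = A i 0 * φ 0 +
        (A i 1 * φ 1 + ∑ n : Fin N, A i n.succ.succ * φ n.succ.succ) := by
      intro i
      simp only [Matrix.mulVec, dotProduct, Fin.sum_univ_succ, Fin.succ_zero_eq_one]
    constructor
    · intro h
      refine ⟨?_, ?_, ?_⟩
      · rw [← hr, h]; rfl
      · rw [← hr, h]; rfl
      · funext m
        rw [← h3, h]; rfl
    · rintro ⟨h0, h1, h2⟩
      funext i
      refine Fin.cases ?_ (fun j => Fin.cases ?_ (fun m => ?_) j) i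
      · rw [hr]; exact h0
      · rw [Fin.succ_zero_eq_one, hr]; exact h1
      · rw [h3, h2]; rfl
  have huniq : ∀ φ ψ : Fin (N + 2) → F, A.mulVec φ = 0 → A.mulVec ψ = 0 →
        (∀ n : Fin N, φ n.succ.succ = ψ n.succ.succ) → φ = ψ := by
    intro φ ψ hφ hψ h
    obtain ⟨a0, a1, -⟩ := (key φ).1 hφ
    obtain ⟨b0, b1, -⟩ := (key ψ).1 hψ
    simp only [h] at a0 a1
    have e0 : φ 0 = ψ 0 := by
      apply mul_left_cancel₀ hd
      linear_combination A 1 1 * (a0 - b0) - A 0 1 * (a1 - b1)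
    have e1 : φ 1 = ψ 1 := by
      apply mul_left_cancel₀ hd
      linear_combination A 0 0 * (a1 - b1) - A 1 0 * (a0 - b0)
    funext i
    refine Fin.cases e0 (fun j => Fin.cases ?_ (fun m => h m) j) i
    rw [Fin.succ_zero_eq_one]; exact e1
  refine ⟨?_, fun φ h => ((key φ).1 h).2.2, huniq⟩
  let f : LinearMap.ker A.mulVecLin →ₗ[F] LinearMap.ker A''.mulVecLin :=
    { toFun := fun φ => ⟨fun n => φ.1 n.succ.succ, ((key φ.1).1 φ.2).2.2⟩
      map_add' := fun _ _ => rfl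
      map_smul' := fun _ _ => rfl }
  refine (LinearEquiv.ofBijective f ⟨?_, ?_⟩).finrank_eq
  · intro φ ψ h
    apply Subtype.ext
    exact huniq φ.1 ψ.1 φ.2 ψ.2 (fun n => congrFun (congrArg Subtype.val h) n)
  · rintro ⟨χ, hχ⟩
    let s := ∑ n : Fin N, A 0 n.succ.succ * χ n
    let t := ∑ n : Fin N, A 1 n.succ.succ * χ n
    let d := A 0 0 * A 1 1 - A 0 1 * A 1 0
    let φ : Fin (N + 2) → F :=
      Fin.cons ((A 0 1 * t - A 1 1 * s) / d) (Fin.cons ((A 1 0 * s - A 0 0 * t) / d) χ)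
    refine ⟨⟨φ, (key φ).2 ⟨?_, ?_, hχ⟩⟩, rfl⟩
    · change A 0 0 * ((A 0 1 * t - A 1 1 * s) / d) +
        (A 0 1 * ((A 1 0 * s - A 0 0 * t) / d) + s) = 0
      have hd' : d ≠ 0 := hd
      field_simp
      simp only [d]
      ring
    · change A 1 0 * ((A 0 1 * t - A 1 1 * s) / d) +
        (A 1 1 * ((A 1 0 * s - A 0 0 * t) / d) + t) = 0
      have hd' : d ≠ 0 := hd
      field_simp
      simp only [d]
      ring
end

section
/- Consider the 8 × 12 real matrix A whose rows are (1,1,−1,0,0,0,0,0,0,0,0,0), (1,0,0,0,−1,0,0,0,1,0,0,0), (0,1,0,0,0,1,−1,0,0,0,0,0), (0,0,0,−1,1,0,0,1,0,0,0,0), (0,0,1,−1,0,0,0,0,0,1,0,0), (0,0,0,0,0,0,−1,0,1,0,1,0), (0,0,0,0,0,0,0,1,0,0,−1,1), (0,0,0,0,0,−1,0,0,0,1,0,1). Then the null space {φ ∈ ℝ¹² : Aφ = 0} has dimension 5; equivalently, A has rank 7, one less than its number of rows, so this eight-triad, twelve-mode cluster kernel has J = N − M* = 12 − 7 = 5 independent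 quadratic invariants, one more than N − M = 4. -/
set_option maxHeartbeats 4000000

/-- the first cluster kernel (8 triads, 12 modes) of the 104-triad
large-scale CHM cluster has nullity 5 and rank 7, i.e. J = N − M* = 5 > N − M = 4. -/
theorem first_cluster_kernel_extra_invariant :
    let A : Matrix (Fin 8) (Fin 12) ℝ :=
      !![1, 1, -1, 0, 0, 0, 0, 0, 0, 0, 0, 0;
         1, 0, 0, 0, -1, 0, 0, 0, 1, 0, 0, 0;
         0, 1, 0, 0, 0, 1, -1, 0, 0, 0, 0, 0;
         0, 0, 0, -1, 1, 0, 0, 1, 0, 0, 0, 0;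
         0, 0, 1, -1, 0, 0, 0, 0, 0, 1, 0, 0;
         0, 0, 0, 0, 0, 0, -1, 0, 1, 0, 1, 0;
         0, 0, 0, 0, 0, 0, 0, 1, 0, 0, -1, 1;
         0, 0, 0, 0, 0, -1, 0, 0, 0, 1, 0, 1]
    Module.finrank ℝ (LinearMap.ker A.mulVecLin) = 5 ∧ A.rank = 7 := by
  intro A
  have hk : Module.finrank ℝ (LinearMap.ker A.mulVecLin) = 5 := by
    -- parametrization of the null space by the coordinates 0, 1, 7, 8, 11
    let B : (Fin 5 → ℝ) →ₗ[ℝ] (Fin 12 → ℝ) :=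
      { toFun := fun v => ![v 0, v 1, v 0 + v 1, v 0 + v 3 + v 2, v 0 + v 3,
          v 3 + v 2 + v 4 - v 1, v 3 + v 2 + v 4, v 2, v 3, v 3 + v 2 - v 1, v 2 + v 4, v 4]
        map_add' := by
          intro v w
          ext i
          fin_cases i <;> simp <;> ring
        map_smul' := by
          intro c v
          ext i
          fin_cases i <;> simp <;> ring }
    have hinj : Function.Injective B := by
      intro v w h
      have h0 : v 0 = w 0 := congrFun h 0
      have h1 : v 1 = w 1 := congrFun h 1
      have h2 : v 2 = w 2 := congrFun h 7
      have h3 : v 3 = w 3 := congrFun h 8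
      have h4 : v 4 = w 4 := congrFun h 11
      ext i
      fin_cases i <;> assumption
    have hker : LinearMap.ker A.mulVecLin = LinearMap.range B := by
      ext x
      rw [LinearMap.mem_ker, LinearMap.mem_range]
      constructor
      · intro h
        have e := fun i => congrFun h i
        simp only [Fin.forall_fin_succ, A] at e
        simp [Matrix.mulVec, dotProduct, Fin.sum_univ_succ] at e
        obtain ⟨e0, e1, e2, e3, e4, e5, e6, e7⟩ := e
        refine ⟨![x 0, x 1, x 7, x 8, x 11], ?_⟩
        ext i
        fin_cases i <;> simp [B] <;> linarith
      · rintro ⟨v, rfl⟩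
        ext i
        fin_cases i <;> simp [A, B, Matrix.mulVec, dotProduct, Fin.sum_univ_succ] <;> ring
    rw [hker, LinearMap.finrank_range_of_inj hinj]
    simp
  refine ⟨hk, ?_⟩
  have h := LinearMap.finrank_range_add_finrank_ker A.mulVecLin
  rw [hk] at h
  simp only [Module.finrank_fin_fun] at h
  rw [Matrix.rank]
  omega
end

section
/- Consider the 8 × 12 real matrix A whose rows are (1,1,−1,0,0,0,0,0,0,0,0,0), (−1,0,0,1,0,1,0,0,0,0,0,0), (0,0,−1,0,1,0,1,0,0,0,0,0), (0,1,0,0,0,0,0,1,−1,0,0,0), (0,0,0,1,−1,0,0,0,0,1,0,0), (0,0,0,0,0,0,0,0,0,1,1,−1), (0,0,0,0,0,0,1,1,0,0,−1,0), (0,0,0,0,0,1,0,0,1,0,0,−1). Then the null space {φ ∈ ℝ¹² : Aφ = 0} has dimension 5; equivalently, A has rank 7, one less than its number of rows, so this eight-triad, twelve-mode cluster kernel has J = N − M* = 12 − 7 = 5 independent quadratic invariants, one more than N − M = 4. -/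
/-- the second cluster kernel (8 triads, 12 modes) of the 104-triad
large-scale CHM cluster has nullity 5 and rank 7, i.e. J = N − M* = 5 > N − M = 4. -/
theorem second_cluster_kernel_extra_invariant :
    let A : Matrix (Fin 8) (Fin 12) ℝ :=
      !![1, 1, -1, 0, 0, 0, 0, 0, 0, 0, 0, 0;
         -1, 0, 0, 1, 0, 1, 0, 0, 0, 0, 0, 0;
         0, 0, -1, 0, 1, 0, 1, 0, 0, 0, 0, 0;
         0, 1, 0, 0, 0, 0, 0, 1, -1, 0, 0, 0;
         0, 0, 0, 1, -1, 0, 0, 0, 0, 1, 0, 0;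
         0, 0, 0, 0, 0, 0, 0, 0, 0, 1, 1, -1;
         0, 0, 0, 0, 0, 0, 1, 1, 0, 0, -1, 0;
         0, 0, 0, 0, 0, 1, 0, 0, 1, 0, 0, -1]
    Module.finrank ℝ (LinearMap.ker A.mulVecLin) = 5 ∧ A.rank = 7 := by
  intro A
  have hmem : ∀ x : Fin 12 → ℝ, x ∈ LinearMap.ker A.mulVecLin ↔
      (x 2 = x 0 + x 1 ∧ x 5 = x 0 - x 3 ∧ x 6 = x 0 + x 1 - x 4 ∧ x 8 = x 1 + x 7 ∧
        x 9 = x 4 - x 3 ∧ x 10 = x 0 + x 1 - x 4 + x 7 ∧ x 11 = x 0 + x 1 - x 3 + x 7) := by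
    intro x
    rw [LinearMap.mem_ker, Matrix.mulVecLin_apply, funext_iff]
    simp [A, Fin.forall_fin_succ, Matrix.mulVec, dotProduct, Fin.sum_univ_succ]
    constructor
    · rintro ⟨h1, h2, h3, h4, h5, h6, h7, h8⟩
      refine ⟨?_, ?_, ?_, ?_, ?_, ?_, ?_⟩ <;> linarith
    · rintro ⟨h1, h2, h3, h4, h5, h6, h7⟩
      refine ⟨?_, ?_, ?_, ?_, ?_, ?_, ?_, ?_⟩ <;> linarith
  let e : LinearMap.ker A.mulVecLin ≃ₗ[ℝ] (Fin 5 → ℝ) :=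
    { toFun := fun x => ![x.1 0, x.1 1, x.1 3, x.1 4, x.1 7]
      map_add' := by
        intro x y
        ext i
        fin_cases i <;> rfl
      map_smul' := by
        intro c x
        ext i
        fin_cases i <;> rfl
      invFun := fun y => ⟨![y 0, y 1, y 0 + y 1, y 2, y 3, y 0 - y 2, y 0 + y 1 - y 3, y 4,
        y 1 + y 4, y 3 - y 2, y 0 + y 1 - y 3 + y 4, y 0 + y 1 - y 2 + y 4], by
          rw [hmem]
          exact ⟨rfl, rfl, rfl, rfl, rfl, rfl, rfl⟩⟩
      left_inv := by
        rintro ⟨x, hx⟩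
        obtain ⟨h1, h2, h3, h4, h5, h6, h7⟩ := (hmem x).1 hx
        apply Subtype.ext
        ext i
        fin_cases i
        · rfl
        · rfl
        · exact h1.symm
        · rfl
        · rfl
        · exact h2.symm
        · exact h3.symm
        · rfl
        · exact h4.symm
        · exact h5.symm
        · exact h6.symm
        · exact h7.symm
      right_inv := by
        intro y
        ext i
        fin_cases i <;> rfl }
  have hk : Module.finrank ℝ (LinearMap.ker A.mulVecLin) = 5 := by
    rw [e.finrank_eq]
    simp
  refine ⟨hk, ?_⟩
  have h := LinearMap.finrank_range_add_finrank_ker A.mulVecLin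
  rw [hk, Module.finrank_fin_fun] at h
  unfold Matrix.rank
  omega
end
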